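/- arXiv:1304.0739 — 5 statements merged into one kernel-verified Lean document; each statement's English description precedes it below -/
import Mathlib

section
/- Let 𝓗 be an infinite-dimensional complex Hilbert space. Then (𝓥_f(𝓗); ⊕, o) is a generalized effect algebra, i.e. the partial operation ⊕ on 𝓥_f(𝓗) is well defined into 𝓥_f(𝓗) and satisfies commutativity, associativity, the zero law t ⊕ o = t, the cancellation law (t ⊕ r = t ⊕ s implies r = s), and positivity (t ⊕ s = o implies t = s = o), each law understood so that if one side is defined then so is the other. -/
set_option autoImplicit false

noncomputable section

open Filter

variable {H : Type*}

/-- A densely defined positive bilinear (sesquilinear) form on a complex Hilbert space `H`: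
it is given by a dense domain `dom` and a map `toFun : H → H → ℂ` which is linear in the
first argument and conjugate-linear in the second one on the domain, takes real nonnegative
values on the diagonal of the domain, and (as a normalization) vanishes off the domain. -/
structure PBF (H : Type*) [NormedAddCommGroup H] [InnerProductSpace ℂ H] where
  dom : Submodule ℂ H
  dense' : Dense (dom : Set H)
  toFun : H → H → ℂ
  zero_off : ∀ x y : H, x ∉ dom ∨ y ∉ dom → toFun x y = 0
  add_left : ∀ x y z : H, x ∈ dom → y ∈ dom → z ∈ dom →
    toFun (x + y) z = toFun x z + toFun y z
  smul_left : ∀ (c : ℂ) (x y : H), x ∈ dom → y ∈ dom →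
    toFun (c • x) y = c * toFun x y
  add_right : ∀ x y z : H, x ∈ dom → y ∈ dom → z ∈ dom →
    toFun x (y + z) = toFun x y + toFun x z
  smul_right : ∀ (c : ℂ) (x y : H), x ∈ dom → y ∈ dom →
    toFun x (c • y) = (starRingEnd ℂ) c * toFun x y
  re_nonneg : ∀ x : H, x ∈ dom → 0 ≤ (toFun x x).re
  im_zero : ∀ x : H, x ∈ dom → (toFun x x).im = 0

variable [NormedAddCommGroup H] [InnerProductSpace ℂ H]

namespace PBF

/-- A positive bilinear form is bounded if `sup {t(x,x) : x ∈ D(t), ‖x‖ = 1} < ∞`. -/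
def Bounded (t : PBF H) : Prop :=
  ∃ c : ℝ, ∀ x ∈ t.dom, (t.toFun x x).re ≤ c * ‖x‖ ^ 2

/-- Membership in `𝓥_f(𝓗)`: a positive bilinear form whose domain is all of `H`
whenever the form is bounded. -/
def InVf (t : PBF H) : Prop := t.Bounded → t.dom = ⊤

/-- `u` is the usual sum `t + s`, with domain `D(t) ⊓ D(s)`. -/
def IsSum (t s u : PBF H) : Prop :=
  u.dom = t.dom ⊓ s.dom ∧
  ∀ x y : H, x ∈ u.dom → y ∈ u.dom → u.toFun x y = t.toFun x y + s.toFun x y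

/-- Definedness of the partial operation `⊕` on `𝓥_f(𝓗)`:
`t ⊕ s` is defined iff `t` or `s` is bounded, or `D(t) = D(s)`. -/
def OplusDef (t s : PBF H) : Prop := t.Bounded ∨ s.Bounded ∨ t.dom = s.dom

/-- `t ⊕ s = u` in `𝓥_f(𝓗)`. -/
def Oplus (t s u : PBF H) : Prop := OplusDef t s ∧ IsSum t s u

/-- The squared norm `‖x‖_t² = t(x,x) + ‖x‖²` associated with the inner product
`(x,y)_t := t(x,y) + (x,y)` on `D(t)`. -/
def q (t : PBF H) (x : H) : ℝ := (t.toFun x x).re + ‖x‖ ^ 2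

/-- `t` is closed: `D(t)` is complete under the inner product `(x,y)_t := t(x,y) + (x,y)`
(sequential formulation of completeness). -/
def IsClosedForm (t : PBF H) : Prop :=
  ∀ f : ℕ → H, (∀ n, f n ∈ t.dom) →
    (∀ ε : ℝ, 0 < ε → ∃ N : ℕ, ∀ m ≥ N, ∀ n ≥ N, t.q (f m - f n) < ε) →
    ∃ x ∈ t.dom, Tendsto (fun n => t.q (f n - x)) atTop (nhds 0)

/-- `s` is an extension of `t` (i.e. `s|_{D(t)} = t`). -/
def Extends (s t : PBF H) : Prop :=
  t.dom ≤ s.dom ∧ ∀ x y : H, x ∈ t.dom → y ∈ t.dom → s.toFun x y = t.toFun x y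

/-- `t` is closable (equivalently, regular) iff it has a closed extension. -/
def Closable (t : PBF H) : Prop := ∃ s : PBF H, s.IsClosedForm ∧ s.Extends t

/-- `t` is singular: the only closable positive bilinear form `r` with `D(r) = D(t)` and
`r(x,x) ≤ t(x,x)` on `D(t)` is the zero form. -/
def Singular (t : PBF H) : Prop :=
  ∀ r : PBF H, r.Closable → r.dom = t.dom →
    (∀ x ∈ t.dom, (r.toFun x x).re ≤ (t.toFun x x).re) →
    ∀ x y : H, r.toFun x y = 0

/-- `tr` is the regular part of `t`: the largest closable positive bilinear form `r` with
`D(r) = D(t)` and `r(x,x) ≤ t(x,x)` for all `x ∈ D(t)` (Simon's decomposition theorem). -/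
def IsRegularPart (t tr : PBF H) : Prop :=
  tr.Closable ∧ tr.dom = t.dom ∧
  (∀ x ∈ t.dom, (tr.toFun x x).re ≤ (t.toFun x x).re) ∧
  ∀ r : PBF H, r.Closable → r.dom = t.dom →
    (∀ x ∈ t.dom, (r.toFun x x).re ≤ (t.toFun x x).re) →
    ∀ x ∈ t.dom, (r.toFun x x).re ≤ (tr.toFun x x).re

end PBF

/-- The zero form `o`, with `D(o) = 𝓗`. -/
def zeroPBF (H : Type*) [NormedAddCommGroup H] [InnerProductSpace ℂ H] : PBF H where
  dom := ⊤
  dense' := by rw [Submodule.top_coe]; exact dense_univ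
  toFun := fun _ _ => 0
  zero_off := fun _ _ _ => rfl
  add_left := by intros; simp
  smul_left := by intros; simp
  add_right := by intros; simp
  smul_right := by intros; simp
  re_nonneg := by intros; simp
  im_zero := by intros; simp

/-- `Q` is (the carrier of) a sub-generalized effect algebra of `(𝓥_f(𝓗); ⊕, o)`:
it contains `o`, and whenever `x ⊕ y = z` in `𝓥_f(𝓗)` with at least two of `x, y, z`
in `Q`, then all three are in `Q`. -/
def SubGEACond (Q : PBF H → Prop) : Prop :=
  Q (zeroPBF H) ∧
  ∀ x y z : PBF H, x.InVf → y.InVf → z.InVf → PBF.Oplus x y z →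
    ((Q x ∧ Q y) ∨ (Q x ∧ Q z) ∨ (Q y ∧ Q z)) → (Q x ∧ Q y ∧ Q z)

/-- Membership in the generalized effect algebra carried by `{t ∈ 𝓥_f(𝓗) : Q t}`. -/
def MemAlg (Q : PBF H → Prop) (t : PBF H) : Prop := t.InVf ∧ Q t

/-- The order induced by the restricted operation `⊕|_Q` on `{t ∈ 𝓥_f(𝓗) : Q t}`:
`s ≤ t` iff `s ⊕ r = t` for some `r` in the algebra. -/
def leQ (Q : PBF H → Prop) (s t : PBF H) : Prop :=
  ∃ r : PBF H, MemAlg Q r ∧ PBF.Oplus s r t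

/-- The order induced by `⊕` on `𝓥_f(𝓗)`: `s ≤ t` iff `s ⊕ r = t` for some `r ∈ 𝓥_f(𝓗)`. -/
def leVf (s t : PBF H) : Prop := ∃ r : PBF H, r.InVf ∧ PBF.Oplus s r t

/-- The algebra `{t ∈ 𝓥_f(𝓗) : Q t}` is monotone Dedekind upwards σ-complete: every
non-decreasing sequence dominated by some element has a supremum (w.r.t. the induced order). -/
def UpSigmaQ (Q : PBF H → Prop) : Prop :=
  ∀ f : ℕ → PBF H, (∀ n, MemAlg Q (f n)) → (∀ n, leQ Q (f n) (f (n + 1))) →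
    (∃ b : PBF H, MemAlg Q b ∧ ∀ n, leQ Q (f n) b) →
    ∃ s : PBF H, MemAlg Q s ∧ (∀ n, leQ Q (f n) s) ∧
      ∀ z : PBF H, MemAlg Q z → (∀ n, leQ Q (f n) z) → leQ Q s z

/-- The algebra `{t ∈ 𝓥_f(𝓗) : Q t}` is monotone Dedekind downwards σ-complete: every
non-increasing sequence has an infimum (w.r.t. the induced order). -/
def DownSigmaQ (Q : PBF H → Prop) : Prop :=
  ∀ f : ℕ → PBF H, (∀ n, MemAlg Q (f n)) → (∀ n, leQ Q (f (n + 1)) (f n)) →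
    ∃ i : PBF H, MemAlg Q i ∧ (∀ n, leQ Q i (f n)) ∧
      ∀ z : PBF H, MemAlg Q z → (∀ n, leQ Q z (f n)) → leQ Q z i

namespace PBF

theorem ext_on_dom {s t : PBF H} (hd : s.dom = t.dom)
    (h : ∀ x ∈ s.dom, ∀ y ∈ s.dom, s.toFun x y = t.toFun x y) : s = t := by
  have hf : s.toFun = t.toFun := by
    funext x y
    by_cases hx : x ∈ s.dom ∧ y ∈ s.dom
    · exact h x hx.1 y hx.2
    · have hx' : x ∉ s.dom ∨ y ∉ s.dom := by tauto
      rw [s.zero_off x y hx', t.zero_off x y (hd ▸ hx')]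
  cases s
  cases t
  simp_all

theorem polarization (t : PBF H) {x y : H} (hx : x ∈ t.dom) (hy : y ∈ t.dom) :
    4 * t.toFun x y = t.toFun (x + y) (x + y)
      - t.toFun (x + (-1 : ℂ) • y) (x + (-1 : ℂ) • y)
      + Complex.I * t.toFun (x + Complex.I • y) (x + Complex.I • y)
      - Complex.I * t.toFun (x + (-Complex.I) • y) (x + (-Complex.I) • y) := by
  have expand : ∀ c : ℂ, t.toFun (x + c • y) (x + c • y) = t.toFun x x
      + (starRingEnd ℂ) c * t.toFun x y + c * t.toFun y x
      + c * (starRingEnd ℂ) c * t.toFun y y := fun c => by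
    have hc := t.dom.smul_mem c hy
    rw [t.add_left _ _ _ hx hc (t.dom.add_mem hx hc), t.add_right _ _ _ hx hx hc,
      t.add_right _ _ _ hc hx hc, t.smul_left _ _ _ hy hx, t.smul_right _ _ _ hx hy,
      t.smul_left _ _ _ hy hc, t.smul_right _ _ _ hy hy]
    ring
  have expand_one := expand 1
  rw [one_smul] at expand_one
  rw [expand_one, expand, expand, expand]
  simp only [map_one, map_neg, Complex.conj_I]
  linear_combination (2 * t.toFun x y - 2 * t.toFun y x) * Complex.I_mul_I

theorem norm_diag (t : PBF H) {x : H} (hx : x ∈ t.dom) :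
    ‖t.toFun x x‖ = (t.toFun x x).re := by
  rw [← Complex.abs_re_eq_norm.mpr (t.im_zero x hx), abs_of_nonneg (t.re_nonneg x hx)]

theorem norm_le_of_diag_le (t : PBF H) {c : ℝ}
    (hc : ∀ x ∈ t.dom, (t.toFun x x).re ≤ c * ‖x‖ ^ 2) {x y : H}
    (hx : x ∈ t.dom) (hy : y ∈ t.dom) : ‖t.toFun x y‖ ≤ 2 * c * ‖x‖ * ‖y‖ := by
  have sum_sq : ∀ x ∈ t.dom, ∀ y ∈ t.dom, ‖t.toFun x y‖ ≤ c * (‖x‖ ^ 2 + ‖y‖ ^ 2) := by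
    intro x hx y hy
    have diag : ∀ a : ℂ, ‖t.toFun (x + a • y) (x + a • y)‖ ≤ c * ‖x + a • y‖ ^ 2 := fun a => by
      have ha := t.dom.add_mem hx (t.dom.smul_mem a hy)
      rw [t.norm_diag ha]
      exact hc _ ha
    have h1 := diag 1
    have h2 := diag (-1)
    have h3 := diag Complex.I
    have h4 := diag (-Complex.I)
    have p1 := parallelogram_law_with_norm ℂ x y
    have p2 := parallelogram_law_with_norm ℂ x (Complex.I • y)
    have hp := congrArg norm (t.polarization hx hy)
    rw [norm_mul, Complex.norm_ofNat] at hp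
    have tri := (norm_sub_le (t.toFun (x + y) (x + y)
      - t.toFun (x + (-1 : ℂ) • y) (x + (-1 : ℂ) • y)
      + Complex.I * t.toFun (x + Complex.I • y) (x + Complex.I • y))
      (Complex.I * t.toFun (x + (-Complex.I) • y) (x + (-Complex.I) • y))).trans
      (add_le_add_left ((norm_add_le _ _).trans (add_le_add_left (norm_sub_le _ _) _)) _)
    simp only [norm_mul, Complex.norm_I, one_mul, one_smul, neg_smul, ← sub_eq_add_neg,
      norm_smul] at h1 h2 h3 h4 p1 p2 hp tri
    linear_combination (1 / 4) * (hp.le + tri + h1 + h2 + h3 + h4 + c * p1 + c * p2)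
  rcases eq_or_ne x 0 with rfl | hx0
  · have h := t.smul_left 0 0 y hx hy
    rw [zero_smul, zero_mul] at h
    simp [h]
  rcases eq_or_ne y 0 with rfl | hy0
  · have h := t.smul_right 0 x 0 hx hy
    rw [zero_smul, map_zero, zero_mul] at h
    simp [h]
  have hxn : ‖x‖ ≠ 0 := norm_ne_zero_iff.mpr hx0
  have hyn : ‖y‖ ≠ 0 := norm_ne_zero_iff.mpr hy0
  have hx' := t.dom.smul_mem ((‖x‖⁻¹ : ℝ) : ℂ) hx
  have hy' := t.dom.smul_mem ((‖y‖⁻¹ : ℝ) : ℂ) hy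
  have h := sum_sq _ hx' _ hy'
  rw [t.smul_left _ _ _ hx hy', t.smul_right _ _ _ hx hy] at h
  simp only [norm_smul, norm_mul, Complex.conj_ofReal, Complex.norm_real, norm_inv,
    norm_norm, inv_mul_cancel₀ hxn, inv_mul_cancel₀ hyn] at h
  have h' : ‖t.toFun x y‖ = ‖x‖ * ‖y‖ * (‖x‖⁻¹ * (‖y‖⁻¹ * ‖t.toFun x y‖)) := by
    field_simp
  rw [h']
  calc _ ≤ ‖x‖ * ‖y‖ * (c * (1 ^ 2 + 1 ^ 2)) :=
        mul_le_mul_of_nonneg_left h (by positivity)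
    _ = _ := by ring

theorem Bounded.continuous_left {t : PBF H} (ht : t.Bounded) (hd : t.dom = ⊤) (y : H) :
    Continuous fun x => t.toFun x y := by
  obtain ⟨c, hc⟩ := ht
  have mem : ∀ x, x ∈ t.dom := by simp [hd]
  refine AddMonoidHomClass.continuous_of_bound
    (AddMonoidHom.mk' (fun x => t.toFun x y) fun a b => t.add_left a b y (mem _) (mem _) (mem _))
    (2 * c * ‖y‖) fun x => ?_
  have h := t.norm_le_of_diag_le hc (mem x) (mem y)
  simpa [mul_right_comm] using h

theorem Bounded.continuous_right {t : PBF H} (ht : t.Bounded) (hd : t.dom = ⊤) (x : H) :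
    Continuous fun y => t.toFun x y := by
  obtain ⟨c, hc⟩ := ht
  have mem : ∀ x, x ∈ t.dom := by simp [hd]
  exact AddMonoidHomClass.continuous_of_bound
    (AddMonoidHom.mk' (fun y => t.toFun x y) fun a b => t.add_right x a b (mem _) (mem _) (mem _))
    (2 * c * ‖x‖) fun y => t.norm_le_of_diag_le hc (mem x) (mem y)

/-- Bounded everywhere defined forms are determined by their values on a dense set. -/
theorem Bounded.eq_of_eqOn_dense {s r : PBF H} (hs : s.Bounded) (hr : r.Bounded)
    (hsd : s.dom = ⊤) (hrd : r.dom = ⊤) {D : Set H} (hD : Dense D)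
    (h : ∀ x ∈ D, ∀ y ∈ D, s.toFun x y = r.toFun x y) : s = r := by
  refine ext_on_dom (hsd.trans hrd.symm) fun x _ y _ => ?_
  have left : ∀ y ∈ D, ∀ x, s.toFun x y = r.toFun x y := fun y hy => congrFun <|
    (hs.continuous_left hsd y).ext_on hD (hr.continuous_left hrd y) fun x hx => h x hx y hy
  exact congrFun ((hs.continuous_right hsd x).ext_on hD (hr.continuous_right hrd x)
    fun y hy => left y hy x) y

theorem eq_zeroPBF_of_diag_eq_zero {t : PBF H} (hd : t.dom = ⊤)
    (h : ∀ x, (t.toFun x x).re = 0) : t = zeroPBF H := by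
  refine ext_on_dom hd fun x hx y hy => ?_
  have := t.norm_le_of_diag_le (c := 0) (fun x _ => by simp [h x]) hx hy
  simpa [zeroPBF] using this

open scoped Classical in
/-- The usual sum of two forms whose common domain is dense. -/
def sum (t s : PBF H) (hd : Dense ((t.dom ⊓ s.dom : Submodule ℂ H) : Set H)) : PBF H where
  dom := t.dom ⊓ s.dom
  dense' := hd
  toFun x y := if x ∈ t.dom ⊓ s.dom ∧ y ∈ t.dom ⊓ s.dom then t.toFun x y + s.toFun x y else 0
  zero_off x y h := if_neg (by tauto)
  add_left x y z hx hy hz := by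
    rw [if_pos ⟨add_mem hx hy, hz⟩, if_pos ⟨hx, hz⟩, if_pos ⟨hy, hz⟩,
      t.add_left _ _ _ hx.1 hy.1 hz.1, s.add_left _ _ _ hx.2 hy.2 hz.2]
    ring
  smul_left c x y hx hy := by
    rw [if_pos ⟨Submodule.smul_mem _ c hx, hy⟩, if_pos ⟨hx, hy⟩,
      t.smul_left _ _ _ hx.1 hy.1, s.smul_left _ _ _ hx.2 hy.2]
    ring
  add_right x y z hx hy hz := by
    rw [if_pos ⟨hx, add_mem hy hz⟩, if_pos ⟨hx, hy⟩, if_pos ⟨hx, hz⟩,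
      t.add_right _ _ _ hx.1 hy.1 hz.1, s.add_right _ _ _ hx.2 hy.2 hz.2]
    ring
  smul_right c x y hx hy := by
    rw [if_pos ⟨hx, Submodule.smul_mem _ c hy⟩, if_pos ⟨hx, hy⟩,
      t.smul_right _ _ _ hx.1 hy.1, s.smul_right _ _ _ hx.2 hy.2]
    ring
  re_nonneg x hx := by
    rw [if_pos ⟨hx, hx⟩, Complex.add_re]
    exact add_nonneg (t.re_nonneg x hx.1) (s.re_nonneg x hx.2)
  im_zero x hx := by
    rw [if_pos ⟨hx, hx⟩, Complex.add_im, t.im_zero x hx.1, s.im_zero x hx.2, add_zero]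

theorem isSum_sum (t s : PBF H) (hd : Dense ((t.dom ⊓ s.dom : Submodule ℂ H) : Set H)) :
    IsSum t s (sum t s hd) :=
  ⟨rfl, fun _ _ hx hy => if_pos ⟨hx, hy⟩⟩

theorem IsSum.unique {t s u v : PBF H} (hu : IsSum t s u) (hv : IsSum t s v) : u = v := by
  have hd : u.dom = v.dom := hu.1.trans hv.1.symm
  exact ext_on_dom hd fun x hx y hy =>
    (hu.2 x y hx hy).trans (hv.2 x y (hd ▸ hx) (hd ▸ hy)).symm

theorem IsSum.comm {t s u : PBF H} (h : IsSum t s u) : IsSum s t u :=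
  ⟨h.1.trans (inf_comm _ _), fun x y hx hy => (h.2 x y hx hy).trans (add_comm _ _)⟩

theorem IsSum.assoc {t s r u v w : PBF H} (hu : IsSum t s u) (hv : IsSum u r v)
    (hw : IsSum s r w) : IsSum t w v := by
  have hd : v.dom = t.dom ⊓ w.dom := by rw [hv.1, hu.1, hw.1, inf_assoc]
  refine ⟨hd, fun x y hx hy => ?_⟩
  have hvu : v.dom ≤ u.dom := hv.1 ▸ inf_le_left
  have hvw : v.dom ≤ w.dom := hd ▸ inf_le_right
  rw [hv.2 x y hx hy, hu.2 x y (hvu hx) (hvu hy), hw.2 x y (hvw hx) (hvw hy), add_assoc]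

theorem OplusDef.symm {t s : PBF H} (h : OplusDef t s) : OplusDef s t := by
  rcases h with h | h | h
  exacts [.inr (.inl h), .inl h, .inr (.inr h.symm)]

/-- A summand whose domain is that of the sum is bounded whenever the sum is. -/
theorem IsSum.bounded_left {t s u : PBF H} (h : IsSum t s u) (hd : u.dom = t.dom)
    (hu : u.Bounded) : t.Bounded := by
  obtain ⟨c, hc⟩ := hu
  refine ⟨c, fun x hx => le_trans ?_ (hc x (hd ▸ hx))⟩
  have hxu : x ∈ u.dom := hd ▸ hx
  rw [h.2 x x hxu hxu, Complex.add_re]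
  linarith [s.re_nonneg x (h.1 ▸ hxu : x ∈ t.dom ⊓ s.dom).2]

theorem IsSum.bounded {t s u : PBF H} (h : IsSum t s u) (ht : t.Bounded) (hs : s.Bounded) :
    u.Bounded := by
  obtain ⟨c, hc⟩ := ht
  obtain ⟨d, hd⟩ := hs
  refine ⟨c + d, fun x hx => ?_⟩
  have mem : x ∈ t.dom ⊓ s.dom := h.1 ▸ hx
  rw [h.2 x x hx hx, Complex.add_re, add_mul]
  exact add_le_add (hc x mem.1) (hd x mem.2)

/-- When `t ⊕ s` is defined, its domain is the domain of one of the summands. -/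
theorem OplusDef.dom_cases {t s : PBF H} (ht : t.InVf) (hs : s.InVf) (h : OplusDef t s) :
    t.dom ⊓ s.dom = t.dom ∨ t.dom ⊓ s.dom = s.dom := by
  rcases h with h | h | h
  · right; rw [ht h, top_inf_eq]
  · left; rw [hs h, inf_top_eq]
  · left; rw [h, inf_idem]

theorem IsSum.inVf {t s u : PBF H} (h : IsSum t s u) (ht : t.InVf) (hs : s.InVf)
    (hdef : OplusDef t s) : u.InVf := by
  intro hu
  rcases hdef.dom_cases ht hs with hd | hd
  · have hd := h.1.trans hd
    exact hd.trans (ht (h.bounded_left hd hu))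
  · have hd := h.1.trans hd
    exact hd.trans (hs (h.comm.bounded_left hd hu))

theorem exists_isSum {t s : PBF H} (ht : t.InVf) (hs : s.InVf) (h : OplusDef t s) :
    ∃ u : PBF H, u.InVf ∧ IsSum t s u := by
  have hd : Dense ((t.dom ⊓ s.dom : Submodule ℂ H) : Set H) := by
    rcases h.dom_cases ht hs with hd | hd <;> rw [hd]
    exacts [t.dense', s.dense']
  exact ⟨_, (isSum_sum t s hd).inVf ht hs h, isSum_sum t s hd⟩

/-- If a form of `𝓥_f(𝓗)` is bounded, so are both of its summands. -/
theorem IsSum.bounded_of_bounded {t s u : PBF H} (h : IsSum t s u) (hu : u.InVf)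
    (hb : u.Bounded) : t.Bounded ∧ s.Bounded := by
  have hd := h.1
  rw [hu hb, eq_comm, inf_eq_top_iff] at hd
  exact ⟨h.bounded_left ((hu hb).trans hd.1.symm) hb,
    h.comm.bounded_left ((hu hb).trans hd.2.symm) hb⟩

theorem Oplus.assoc {t s r u v : PBF H} (ht : t.InVf) (hs : s.InVf) (hr : r.InVf)
    (hu : u.InVf) (htsu : Oplus t s u) (hurv : Oplus u r v) :
    ∃ w : PBF H, w.InVf ∧ Oplus s r w ∧ Oplus t w v := by
  obtain ⟨hts, sum_u⟩ := htsu
  obtain ⟨hur, sum_v⟩ := hurv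
  have hsr : OplusDef s r := by
    rcases hur with hb | hb | hd
    · exact .inl (sum_u.bounded_of_bounded hu hb).2
    · exact .inr (.inl hb)
    · rcases hts with ht' | hs' | hts
      · exact .inr (.inr (by rw [← hd, sum_u.1, ht ht', top_inf_eq]))
      · exact .inl hs'
      · exact .inr (.inr (by rw [← hd, sum_u.1, hts, inf_idem]))
  obtain ⟨w, hw, sum_w⟩ := exists_isSum hs hr hsr
  refine ⟨w, hw, ⟨hsr, sum_w⟩, ?_, sum_u.assoc sum_v sum_w⟩
  rcases hts with ht' | hs' | hts
  · exact .inl ht'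
  · rcases hur with hb | hb | hd
    · exact .inl (sum_u.bounded_of_bounded hu hb).1
    · exact .inr (.inl (sum_w.bounded hs' hb))
    · exact .inr (.inr (by rw [sum_w.1, ← hd, sum_u.1, hs hs', inf_top_eq, top_inf_eq]))
  · rcases hur with hb | hb | hd
    · exact .inl (sum_u.bounded_of_bounded hu hb).1
    · exact .inr (.inr (by rw [sum_w.1, hr hb, inf_top_eq, hts]))
    · exact .inr (.inr (by rw [sum_w.1, ← hd, sum_u.1, hts, inf_idem, inf_idem]))

/-- If two forms of `𝓥_f(𝓗)` agree on the domain of the second one, and the first one is bounded,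
then they are equal. -/
theorem Bounded.eq_of_agree {s r : PBF H} (hb : s.Bounded) (hs : s.InVf) (hr : r.InVf)
    (h : ∀ x ∈ r.dom, ∀ y ∈ r.dom, s.toFun x y = r.toFun x y) : s = r := by
  have hsd := hs hb
  have hrb : r.Bounded := by
    obtain ⟨c, hc⟩ := hb
    exact ⟨c, fun x hx => h x hx x hx ▸ hc x (by simp [hsd])⟩
  have hd : s.dom = r.dom := hsd.trans (hr hrb).symm
  exact ext_on_dom hd fun x hx y hy => h x (hd ▸ hx) y (hd ▸ hy)

theorem Oplus.cancel {t s r u : PBF H} (ht : t.InVf) (hs : s.InVf) (hr : r.InVf)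
    (h₁ : Oplus t s u) (h₂ : Oplus t r u) : s = r := by
  obtain ⟨hts, sum_s⟩ := h₁
  obtain ⟨htr, sum_r⟩ := h₂
  have agree : ∀ x ∈ u.dom, ∀ y ∈ u.dom, s.toFun x y = r.toFun x y := fun x hx y hy =>
    add_left_cancel ((sum_s.2 x y hx hy).symm.trans (sum_r.2 x y hx hy))
  have dom_or : ∀ {q : PBF H}, OplusDef t q → IsSum t q u → u.dom = q.dom ∨ q.Bounded := by
    rintro q (h | h | h) hq
    · exact .inl (by rw [hq.1, ht h, top_inf_eq])
    · exact .inr h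
    · exact .inl (by rw [hq.1, h, inf_idem])
  rcases dom_or hts sum_s with hus | hsb <;> rcases dom_or htr sum_r with hur | hrb
  · exact ext_on_dom (hus.symm.trans hur) (hus ▸ agree)
  · exact (hrb.eq_of_agree hr hs fun x hx y hy =>
      (agree x (hus ▸ hx) y (hus ▸ hy)).symm).symm
  · exact hsb.eq_of_agree hs hr (hur ▸ agree)
  · exact hsb.eq_of_eqOn_dense hrb (hs hsb) (hr hrb) u.dense' agree

theorem IsSum.eq_zero_of_zero {t s : PBF H} (h : IsSum t s (zeroPBF H)) : t = zeroPBF H := by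
  have hd : (⊤ : Submodule ℂ H) = t.dom ⊓ s.dom := h.1
  rw [eq_comm, inf_eq_top_iff] at hd
  refine eq_zeroPBF_of_diag_eq_zero hd.1 fun x => ?_
  have hx := congrArg Complex.re (h.2 x x (Submodule.mem_top) (Submodule.mem_top))
  have h0 : 0 = (t.toFun x x).re + (s.toFun x x).re := hx
  linarith [t.re_nonneg x (by simp [hd.1]), s.re_nonneg x (by simp [hd.2])]

theorem zeroPBF_bounded : (zeroPBF H).Bounded :=
  ⟨0, fun x _ => by simp [zeroPBF]⟩

end PBF

/-- For an infinite-dimensional complex Hilbert space `H`,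
`(𝓥_f(𝓗); ⊕, o)` is a generalized effect algebra. -/
theorem stmt_1 [CompleteSpace H] (h_inf : ¬ FiniteDimensional ℂ H) :
    -- `o ∈ 𝓥_f(𝓗)`
    (zeroPBF H).InVf ∧
    -- the usual sum is single valued
    (∀ t s u v : PBF H, PBF.IsSum t s u → PBF.IsSum t s v → u = v) ∧
    -- `⊕` is well defined into `𝓥_f(𝓗)`: whenever `t ⊕ s` is defined,
    -- the sum exists and lies in `𝓥_f(𝓗)`
    (∀ t s : PBF H, t.InVf → s.InVf → PBF.OplusDef t s →
      ∃ u : PBF H, u.InVf ∧ PBF.IsSum t s u) ∧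
    -- (GEi) commutativity
    (∀ t s u : PBF H, t.InVf → s.InVf → PBF.Oplus t s u → PBF.Oplus s t u) ∧
    -- (GEii) associativity
    (∀ t s r u v : PBF H, t.InVf → s.InVf → r.InVf → u.InVf → v.InVf →
      PBF.Oplus t s u → PBF.Oplus u r v →
      ∃ w : PBF H, w.InVf ∧ PBF.Oplus s r w ∧ PBF.Oplus t w v) ∧
    -- (GEiii) zero law `t ⊕ o = t`
    (∀ t : PBF H, t.InVf → PBF.Oplus t (zeroPBF H) t) ∧
    -- (GEiv) cancellation
    (∀ t s r u : PBF H, t.InVf → s.InVf → r.InVf →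
      PBF.Oplus t s u → PBF.Oplus t r u → s = r) ∧
    -- (GEv) positivity
    (∀ t s : PBF H, t.InVf → s.InVf → PBF.Oplus t s (zeroPBF H) →
      t = zeroPBF H ∧ s = zeroPBF H) := by
  exact ⟨fun _ => rfl, fun _ _ _ _ hu hv => hu.unique hv,
    fun _ _ ht hs h => PBF.exists_isSum ht hs h,
    fun _ _ _ _ _ h => ⟨h.1.symm, h.2.comm⟩,
    fun _ _ _ _ _ ht hs hr hu _ h₁ h₂ => h₁.assoc ht hs hr hu h₂,
    fun t _ => ⟨.inr (.inl PBF.zeroPBF_bounded), (inf_top_eq t.dom).symm,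
      fun _ _ _ _ => (add_zero _).symm⟩,
    fun _ _ _ _ ht hs hr h₁ h₂ => h₁.cancel ht hs hr h₂,
    fun _ _ _ _ h => ⟨h.2.eq_zero_of_zero, h.2.comm.eq_zero_of_zero⟩⟩
end
end

section
/- Let 𝓗 be an infinite-dimensional complex Hilbert space and let 𝓑_f(𝓗) be the set of bounded elements of 𝓥_f(𝓗). Then 𝓑_f(𝓗) is a sub-generalized effect algebra of (𝓥_f(𝓗); ⊕, o); in particular, the sum of two bounded positive bilinear forms on 𝓗 is bounded, and whenever r ⊕ s = t in 𝓥_f(𝓗) with t and r bounded, then s is bounded (hence D(s) = 𝓗). -/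
set_option autoImplicit false

noncomputable section

open Filter

variable {H : Type*}

variable [NormedAddCommGroup H] [InnerProductSpace ℂ H]

/-- If the sum `t + s = u` is everywhere defined, then so is `s`. -/
theorem PBF.IsSum.dom_right_eq_top {t s u : PBF H} (h : PBF.IsSum t s u) (hu : u.dom = ⊤) :
    s.dom = ⊤ :=
  (inf_eq_top_iff.mp (h.1.symm.trans hu)).2

theorem PBF.IsSum.symm {t s u : PBF H} (h : PBF.IsSum t s u) : PBF.IsSum s t u :=
  ⟨h.1.trans (inf_comm _ _), fun x y hx hy => (h.2 x y hx hy).trans (add_comm _ _)⟩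

theorem PBF.IsSum.bounded_s2 {t s u : PBF H} (h : PBF.IsSum t s u) (ht : t.Bounded)
    (hs : s.Bounded) : u.Bounded := by
  obtain ⟨c, hc⟩ := ht
  obtain ⟨d, hd⟩ := hs
  refine ⟨c + d, fun x hx => ?_⟩
  have hx' : x ∈ t.dom ⊓ s.dom := h.1 ▸ hx
  rw [h.2 x x hx hx, Complex.add_re, add_mul]
  exact add_le_add (hc x hx'.1) (hd x hx'.2)

/-- A summand of a bounded, everywhere defined form is bounded. -/
theorem PBF.IsSum.bounded_right {t s u : PBF H} (h : PBF.IsSum t s u) (hu : u.Bounded)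
    (htop : u.dom = ⊤) : s.Bounded := by
  obtain ⟨c, hc⟩ := hu
  refine ⟨c, fun x _ => ?_⟩
  have hx : x ∈ u.dom := htop ▸ Submodule.mem_top
  have hx' : x ∈ t.dom ⊓ s.dom := h.1 ▸ hx
  have hle := hc x hx
  rw [h.2 x x hx hx, Complex.add_re] at hle
  linarith [t.re_nonneg x hx'.1]

theorem zeroPBF_bounded : (zeroPBF H).Bounded :=
  ⟨0, fun x _ => by simp [zeroPBF]⟩

/-- `𝓑_f(𝓗)`, the set of bounded elements of `𝓥_f(𝓗)`, is a
sub-generalized effect algebra of `(𝓥_f(𝓗); ⊕, o)`; in particular the sum of two bounded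
positive bilinear forms is bounded, and if `r ⊕ s = t` with `t, r` bounded then `s` is
bounded (hence `D(s) = 𝓗`). -/
theorem stmt_2 [CompleteSpace H] (h_inf : ¬ FiniteDimensional ℂ H) :
    -- `𝓑_f(𝓗)` is a sub-generalized effect algebra of `(𝓥_f(𝓗); ⊕, o)`
    SubGEACond (fun t : PBF H => t.Bounded) ∧
    -- the sum of two bounded positive bilinear forms is bounded
    (∀ t s u : PBF H, t.Bounded → s.Bounded → PBF.IsSum t s u → u.Bounded) ∧
    -- if `r ⊕ s = t` in `𝓥_f(𝓗)` with `t` and `r` bounded, then `s` is bounded and `D(s) = 𝓗`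
    (∀ r s t : PBF H, r.InVf → s.InVf → t.InVf → PBF.Oplus r s t →
      r.Bounded → t.Bounded → s.Bounded ∧ s.dom = ⊤) := by
  refine ⟨⟨zeroPBF_bounded, ?_⟩, fun t s u ht hs h => h.bounded_s2 ht hs, ?_⟩
  · rintro x y z - - hz ⟨-, h⟩ (⟨hx, hy⟩ | ⟨hx, hzb⟩ | ⟨hy, hzb⟩)
    · exact ⟨hx, hy, h.bounded_s2 hx hy⟩
    · exact ⟨hx, h.bounded_right hzb (hz hzb), hzb⟩
    · exact ⟨h.symm.bounded_right hzb (hz hzb), hy, hzb⟩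
  · rintro r s t - - ht ⟨-, h⟩ - htb
    exact ⟨h.bounded_right htb (ht htb), h.dom_right_eq_top (ht htb)⟩
end
end

section
/- Let 𝓗 be an infinite-dimensional complex Hilbert space. Then 𝓡_f(𝓗) is not a sub-generalized effect algebra of (𝓥_f(𝓗); ⊕, o): there exist nonzero closable positive bilinear forms t, r ∈ 𝓥_f(𝓗) and a nonzero singular positive bilinear form s ∈ 𝓥_f(𝓗) with D(t) = D(s) = D(r) such that t + s = r. -/
set_option autoImplicit false

noncomputable section

open Filter

variable {H : Type*}

variable [NormedAddCommGroup H] [InnerProductSpace ℂ H]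

/-- The form `(B x, B y) ↦ a ⟨x, y⟩ + b φ(x) conj(φ(y))` on the range of an injective operator `B`,
where `φ` is the functional represented by `v`; it is zero off the range. -/
def rangeFormFun (B : H →L[ℂ] H) (v : H) (a b : ℝ) (x y : H) : ℂ :=
  open Classical in
  if x ∈ LinearMap.range B.toLinearMap ∧ y ∈ LinearMap.range B.toLinearMap then
    a * inner ℂ (Function.invFun B y) (Function.invFun B x)
      + b * (inner ℂ v (Function.invFun B x) *
        (starRingEnd ℂ) (inner ℂ v (Function.invFun B y)))
  else 0

theorem rangeFormFun_apply {B : H →L[ℂ] H} (hB : Function.Injective B) (v : H) (a b : ℝ)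
    (x y : H) :
    rangeFormFun B v a b (B x) (B y) =
      a * inner ℂ y x + b * (inner ℂ v x * (starRingEnd ℂ) (inner ℂ v y)) := by
  simp [rangeFormFun, Function.leftInverse_invFun hB _]

theorem rangeFormFun_self {B : H →L[ℂ] H} (hB : Function.Injective B) (v : H) (a b : ℝ) (x : H) :
    rangeFormFun B v a b (B x) (B x) = ((a * ‖x‖ ^ 2 + b * ‖inner ℂ v x‖ ^ 2 : ℝ) : ℂ) := by
  rw [rangeFormFun_apply hB, Complex.mul_conj, Complex.normSq_eq_norm_sq,
    inner_self_eq_norm_sq_to_K]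
  push_cast
  rfl

/-- The positive form given by `rangeFormFun` when `B` is injective with dense range. -/
def rangeForm (B : H →L[ℂ] H) (hB : Function.Injective B) (hd : DenseRange B) (v : H)
    (a b : ℝ) (ha : 0 ≤ a) (hb : 0 ≤ b) : PBF H where
  dom := LinearMap.range B.toLinearMap
  dense' := hd
  toFun := rangeFormFun B v a b
  zero_off := by
    intro x y h
    rw [rangeFormFun, if_neg]
    tauto
  add_left := by
    rintro _ _ _ ⟨x, rfl⟩ ⟨y, rfl⟩ ⟨z, rfl⟩
    simp only [ContinuousLinearMap.coe_coe, ← map_add B, rangeFormFun_apply hB, inner_add_right]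
    ring
  smul_left := by
    rintro c _ _ ⟨x, rfl⟩ ⟨y, rfl⟩
    simp only [ContinuousLinearMap.coe_coe, ← map_smul B, rangeFormFun_apply hB, inner_smul_right]
    ring
  add_right := by
    rintro _ _ _ ⟨x, rfl⟩ ⟨y, rfl⟩ ⟨z, rfl⟩
    simp only [ContinuousLinearMap.coe_coe, ← map_add B, rangeFormFun_apply hB, inner_add_right,
      inner_add_left, map_add (starRingEnd ℂ)]
    ring
  smul_right := by
    rintro c _ _ ⟨x, rfl⟩ ⟨y, rfl⟩
    simp only [ContinuousLinearMap.coe_coe, ← map_smul B, rangeFormFun_apply hB, inner_smul_right,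
      inner_smul_left, map_mul (starRingEnd ℂ)]
    ring
  re_nonneg := by
    rintro _ ⟨x, rfl⟩
    rw [ContinuousLinearMap.coe_coe, rangeFormFun_self hB, Complex.ofReal_re]
    positivity
  im_zero := by
    rintro _ ⟨x, rfl⟩
    rw [ContinuousLinearMap.coe_coe, rangeFormFun_self hB, Complex.ofReal_im]

section RangeForm

variable {B : H →L[ℂ] H} (hB : Function.Injective B) (hd : DenseRange B) {v : H}
  {a b : ℝ} (ha : 0 ≤ a) (hb : 0 ≤ b)

theorem mem_rangeForm_dom (x : H) : B x ∈ (rangeForm B hB hd v a b ha hb).dom :=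
  ⟨x, rfl⟩

theorem rangeForm_apply (x y : H) :
    (rangeForm B hB hd v a b ha hb).toFun (B x) (B y) =
      a * inner ℂ y x + b * (inner ℂ v x * (starRingEnd ℂ) (inner ℂ v y)) :=
  rangeFormFun_apply hB v a b x y

theorem rangeForm_re_self (x : H) :
    ((rangeForm B hB hd v a b ha hb).toFun (B x) (B x)).re =
      a * ‖x‖ ^ 2 + b * ‖inner ℂ v x‖ ^ 2 := by
  change (rangeFormFun B v a b (B x) (B x)).re = _
  rw [rangeFormFun_self hB, Complex.ofReal_re]

theorem rangeForm_isClosedForm [CompleteSpace H] (hb : 0 ≤ b) :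
    (rangeForm B hB hd v 1 b zero_le_one hb).IsClosedForm := by
  intro f hf hc
  choose g hg using hf
  obtain rfl : (fun n => B (g n)) = f := funext hg
  have hq : ∀ x, (rangeForm B hB hd v 1 b zero_le_one hb).q (B x) =
      ‖x‖ ^ 2 + b * ‖inner ℂ v x‖ ^ 2 + ‖B x‖ ^ 2 := by
    intro x
    rw [PBF.q, rangeForm_re_self, one_mul]
  have hcau : CauchySeq g := by
    rw [Metric.cauchySeq_iff]
    intro ε hε
    obtain ⟨N, hN⟩ := hc (ε ^ 2) (by positivity)
    refine ⟨N, fun m hm n hn => ?_⟩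
    have h := hN m hm n hn
    rw [← map_sub, hq] at h
    rw [dist_eq_norm]
    have h1 : 0 ≤ b * ‖inner ℂ v (g m - g n)‖ ^ 2 := by positivity
    have h2 : 0 ≤ ‖B (g m - g n)‖ ^ 2 := by positivity
    exact lt_of_pow_lt_pow_left₀ 2 hε.le (by linarith)
  obtain ⟨x, hx⟩ := cauchySeq_tendsto_of_complete hcau
  refine ⟨B x, mem_rangeForm_dom .., ?_⟩
  have hcont : Continuous fun y : H =>
      ‖y - x‖ ^ 2 + b * ‖inner ℂ v (y - x)‖ ^ 2 + ‖B (y - x)‖ ^ 2 := by fun_prop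
  have h := (hcont.tendsto x).comp hx
  simpa [← map_sub, hq, Function.comp_def] using h

theorem rangeForm_closable [CompleteSpace H] (hb : 0 ≤ b) :
    (rangeForm B hB hd v 1 b zero_le_one hb).Closable :=
  ⟨_, rangeForm_isClosedForm hB hd hb, le_rfl, fun _ _ _ _ => rfl⟩

theorem rangeForm_not_bounded {u : ℕ → H} (hvu : ∀ n, inner ℂ v (u n) = 1)
    (hu : Tendsto (fun n => B (u n)) atTop (nhds 0)) (hab : 0 < a + b) :
    ¬ (rangeForm B hB hd v a b ha hb).Bounded := by
  rintro ⟨c, hc⟩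
  have hv : v ≠ 0 := by
    rintro rfl
    simpa using hvu 0
  have hv' : 0 < ‖v‖ ^ 2 := by positivity
  have hle : ∀ n, a + b * ‖v‖ ^ 2 ≤ ‖v‖ ^ 2 * (c * ‖B (u n)‖ ^ 2) := by
    intro n
    have h := hc _ (mem_rangeForm_dom hB hd ha hb (u n))
    rw [rangeForm_re_self, hvu, norm_one] at h
    have h1 : 1 ≤ ‖v‖ * ‖u n‖ := by
      simpa [hvu] using norm_inner_le_norm (𝕜 := ℂ) v (u n)
    have h2 : 1 ≤ ‖v‖ ^ 2 * ‖u n‖ ^ 2 := by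
      rw [← mul_pow]
      exact one_le_pow₀ h1
    calc a + b * ‖v‖ ^ 2 ≤ a * (‖v‖ ^ 2 * ‖u n‖ ^ 2) + b * ‖v‖ ^ 2 := by
          gcongr
          exact le_mul_of_one_le_right ha h2
      _ = ‖v‖ ^ 2 * (a * ‖u n‖ ^ 2 + b * 1 ^ 2) := by ring
      _ ≤ _ := by gcongr
  have hlim : Tendsto (fun n => ‖v‖ ^ 2 * (c * ‖B (u n)‖ ^ 2)) atTop (nhds 0) := by
    simpa using ((hu.norm.pow 2).const_mul c).const_mul (‖v‖ ^ 2)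
  have h0 := ge_of_tendsto' hlim hle
  rcases hb.eq_or_lt with rfl | hb'
  · linarith
  · have := mul_pos hb' hv'
    linarith

end RangeForm

namespace PBF

theorem re_sub_add_re_add (r : PBF H) {x y : H} (hx : x ∈ r.dom) (hy : y ∈ r.dom) :
    (r.toFun (x + y) (x + y)).re + (r.toFun (x - y) (x - y)).re =
      2 * (r.toFun x x).re + 2 * (r.toFun y y).re := by
  have hy' : (-1 : ℂ) • y ∈ r.dom := r.dom.smul_mem _ hy
  have hs : x - y = x + (-1 : ℂ) • y := by simp [sub_eq_add_neg]
  rw [hs, r.add_left _ _ _ hx hy (r.dom.add_mem hx hy), r.add_right _ _ _ hx hx hy,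
    r.add_right _ _ _ hy hx hy, r.add_left _ _ _ hx hy' (r.dom.add_mem hx hy'),
    r.add_right _ _ _ hx hx hy', r.add_right _ _ _ hy' hx hy', r.smul_left _ _ _ hy hx,
    r.smul_left _ _ _ hy hy', r.smul_right _ _ _ hx hy, r.smul_right _ _ _ hy hy]
  simp
  ring

theorem toFun_eq_zero_of_re_self (r : PBF H) (h : ∀ x ∈ r.dom, (r.toFun x x).re = 0) (x y : H) :
    r.toFun x y = 0 := by
  by_cases hxy : x ∈ r.dom ∧ y ∈ r.dom
  swap
  · exact r.zero_off x y (by tauto)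
  obtain ⟨hx, hy⟩ := hxy
  have h0 : ∀ z ∈ r.dom, r.toFun z z = 0 := fun z hz => Complex.ext (h z hz) (r.im_zero z hz)
  have hy' : Complex.I • y ∈ r.dom := r.dom.smul_mem _ hy
  have h1 := h0 _ (r.dom.add_mem hx hy)
  have h2 := h0 _ (r.dom.add_mem hx hy')
  rw [r.add_left _ _ _ hx hy (r.dom.add_mem hx hy), r.add_right _ _ _ hx hx hy,
    r.add_right _ _ _ hy hx hy, h0 x hx, h0 y hy] at h1
  rw [r.add_left _ _ _ hx hy' (r.dom.add_mem hx hy'), r.add_right _ _ _ hx hx hy',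
    r.add_right _ _ _ hy' hx hy', h0 x hx, h0 _ hy', r.smul_left _ _ _ hy hx,
    r.smul_right _ _ _ hx hy, Complex.conj_I] at h2
  have h3 : Complex.I * (2 * r.toFun x y) = 0 := by
    linear_combination Complex.I * h1 - h2
  simpa using h3

/-- A closable form is continuous at `0` along null sequences that are Cauchy for the form. -/
theorem Closable.tendsto_re_self {r : PBF H} (hr : r.Closable) {f : ℕ → H}
    (hf : ∀ n, f n ∈ r.dom) (hf0 : Tendsto f atTop (nhds 0))
    (hc : ∀ m n, (r.toFun (f m - f n) (f m - f n)).re ≤ 0) :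
    Tendsto (fun n => (r.toFun (f n) (f n)).re) atTop (nhds 0) := by
  obtain ⟨r', hcl, hdom, hext⟩ := hr
  have hf' : ∀ n, f n ∈ r'.dom := fun n => hdom (hf n)
  obtain ⟨w, hw, hlim⟩ := hcl f hf' (by
    intro ε hε
    obtain ⟨N, hN⟩ := Metric.cauchySeq_iff.1 hf0.cauchySeq (√ε) (Real.sqrt_pos.2 hε)
    refine ⟨N, fun m hm n hn => ?_⟩
    have h1 := hN m hm n hn
    rw [dist_eq_norm, Real.lt_sqrt (norm_nonneg _)] at h1
    have hmem := r.dom.sub_mem (hf m) (hf n)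
    rw [q, hext _ _ hmem hmem]
    linarith [hc m n])
  have hnorm : Tendsto (fun n => ‖f n - w‖ ^ 2) atTop (nhds 0) :=
    squeeze_zero (fun n => by positivity)
      (fun n => by
        have := r'.re_nonneg _ (r'.dom.sub_mem (hf' n) hw)
        rw [q]
        linarith) hlim
  have hnorm' : Tendsto (fun n => ‖f n - w‖ ^ 2) atTop (nhds (‖(0 : H) - w‖ ^ 2)) :=
    ((hf0.sub_const w).norm).pow 2
  have hw0 : w = 0 := by
    have := tendsto_nhds_unique hnorm hnorm'
    simpa using this.symm
  subst hw0
  refine squeeze_zero (fun n => r.re_nonneg _ (hf n)) (fun n => ?_) hlim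
  rw [sub_zero, q, hext _ _ (hf n) (hf n)]
  have : 0 ≤ ‖f n‖ ^ 2 := by positivity
  linarith

end PBF

theorem rangeForm_singular {B : H →L[ℂ] H} (hB : Function.Injective B) (hd : DenseRange B)
    {v : H} {b : ℝ} (hb : 0 ≤ b) {u : ℕ → H} (hvu : ∀ n, inner ℂ v (u n) = 1)
    (hu : Tendsto (fun n => B (u n)) atTop (nhds 0)) :
    (rangeForm B hB hd v 0 b le_rfl hb).Singular := by
  intro r hr hdom hle
  have hmem : ∀ x, B x ∈ r.dom := fun x => hdom ▸ mem_rangeForm_dom hB hd le_rfl hb x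
  have hker : ∀ x, inner ℂ v x = 0 → (r.toFun (B x) (B x)).re ≤ 0 := by
    intro x hx
    refine (hle _ (mem_rangeForm_dom hB hd le_rfl hb x)).trans ?_
    rw [rangeForm_re_self, hx]
    simp
  apply r.toFun_eq_zero_of_re_self
  intro y hy
  rw [hdom] at hy
  obtain ⟨x, rfl⟩ := hy
  change (r.toFun (B x) (B x)).re = 0
  refine le_antisymm ?_ (r.re_nonneg _ (hmem x))
  set c : ℂ := inner ℂ v x with hc
  have hlim : Tendsto (fun n => (r.toFun (B (c • u n)) (B (c • u n))).re) atTop (nhds 0) := by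
    refine hr.tendsto_re_self (f := fun n => B (c • u n)) (fun n => hmem _) ?_ ?_
    · simpa using hu.const_smul c
    · intro m n
      rw [← map_sub]
      apply hker
      simp [hvu]
  have hlim2 := hlim.const_mul 2
  rw [mul_zero] at hlim2
  refine ge_of_tendsto' hlim2 fun n => ?_
  have h1 := r.re_sub_add_re_add (hmem (c • u n)) (hmem (x - c • u n))
  have h2 := r.re_nonneg _ (r.dom.sub_mem (hmem (c • u n)) (hmem (x - c • u n)))
  have h3 : (r.toFun (B (x - c • u n)) (B (x - c • u n))).re ≤ 0 :=
    hker _ (by simp [hvu, hc])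
  rw [← map_add, add_sub_cancel] at h1
  linarith

theorem exists_orthonormal_nat [CompleteSpace H] (h_inf : ¬ FiniteDimensional ℂ H) :
    ∃ e : ℕ → H, Orthonormal ℂ e := by
  obtain ⟨w, b, -⟩ := exists_hilbertBasis ℂ H
  have hw : Infinite w := by
    by_contra hfin
    rw [not_infinite_iff_finite] at hfin
    apply h_inf
    have hfd : FiniteDimensional ℂ (Submodule.span ℂ (Set.range b)) :=
      FiniteDimensional.span_of_finite ℂ (Set.finite_range b)
    have h := b.dense_span
    rw [(Submodule.closed_of_finiteDimensional _).submodule_topologicalClosure_eq] at h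
    rw [h] at hfd
    exact Module.Finite.of_surjective (⊤ : Submodule ℂ H).subtype fun x => ⟨⟨x, trivial⟩, rfl⟩
  exact ⟨_, b.orthonormal.comp _ (Infinite.natEmbedding w).injective⟩

/-- On an infinite-dimensional Hilbert space there is an injective bounded operator `B` with dense
range and a vector `v` such that `B x ↦ ⟨v, x⟩` is a discontinuous functional. -/
theorem exists_injective_denseRange_tendsto_zero [CompleteSpace H]
    (h_inf : ¬ FiniteDimensional ℂ H) :
    ∃ (B : H →L[ℂ] H) (v : H) (u : ℕ → H), Function.Injective B ∧ DenseRange B ∧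
      (∀ n, inner ℂ v (u n) = 1) ∧ Tendsto (fun n => B (u n)) atTop (nhds 0) := by
  obtain ⟨e, he⟩ := exists_orthonormal_nat h_inf
  have hen : ∀ n, ‖e n‖ = 1 := he.1
  have hee : ∀ m n, inner ℂ (e m) (e n) = if m = n then (1 : ℂ) else 0 :=
    orthonormal_iff_ite.1 he
  set K : Submodule ℂ H := (Submodule.span ℂ (Set.range e))ᗮ with hK
  have hKmem : ∀ x, x ∈ K ↔ ∀ n, inner ℂ (e n) x = 0 := by
    intro x
    rw [hK, Submodule.mem_orthogonal]
    refine ⟨fun h n => h _ (Submodule.subset_span ⟨n, rfl⟩), fun h y hy => ?_⟩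
    induction hy using Submodule.span_induction with
    | mem y hy => obtain ⟨n, rfl⟩ := hy; exact h n
    | zero => simp
    | add y z _ _ hy hz => rw [inner_add_left, hy, hz, add_zero]
    | smul c y _ hy => rw [inner_smul_left, hy, mul_zero]
  let T : ℕ → H →L[ℂ] H := fun n => ((1 / 4 : ℂ) ^ n) • (innerSL ℂ (e n)).smulRight (e n)
  have hT : Summable T := by
    refine Summable.of_norm_bounded (g := fun n => (1 / 4 : ℝ) ^ n)
      (summable_geometric_of_lt_one (by norm_num) (by norm_num)) fun n => ?_
    simp [T, norm_smul, hen, ContinuousLinearMap.norm_smulRight_apply]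
  have hTx : ∀ x, HasSum (fun n => ((1 / 4 : ℂ) ^ n * inner ℂ (e n) x) • e n) ((∑' n, T n) x) := by
    intro x
    have h := (ContinuousLinearMap.apply ℂ H x).hasSum hT.hasSum
    simpa [T, Function.comp_def, smul_smul] using h
  have hv : Summable fun n => (1 / 2 : ℂ) ^ n • e n := by
    refine Summable.of_norm_bounded (g := fun n => (1 / 2 : ℝ) ^ n)
      (summable_geometric_of_lt_one (by norm_num) (by norm_num)) fun n => ?_
    simp [norm_smul, hen]
  let B : H →L[ℂ] H := K.starProjection + ∑' n, T n
  have hBK : ∀ x ∈ K, B x = x := by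
    intro x hx
    have h := hTx x
    simp only [(hKmem x).1 hx, mul_zero, zero_smul] at h
    have h0 : (∑' n, T n) x = 0 := h.unique hasSum_zero
    simp only [B, add_apply, h0, add_zero]
    exact Submodule.starProjection_eq_self_iff.2 hx
  have hBinner : ∀ n x, inner ℂ (e n) (B x) = (1 / 4 : ℂ) ^ n * inner ℂ (e n) x := by
    intro n x
    have h1 : inner ℂ (e n) (K.starProjection x) = 0 :=
      (hKmem _).1 (Submodule.starProjection_apply_mem K x) n
    have h2 := (innerSL ℂ (e n)).hasSum (hTx x)
    have h3 := h2.unique (hasSum_single n fun m hm => by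
      simp [hee, hm.symm])
    simp only [B, add_apply, inner_add_right, h1, zero_add]
    simpa [inner_smul_right, hee, hen] using h3
  have hBe : ∀ n, B (e n) = (1 / 4 : ℂ) ^ n • e n := by
    intro n
    have h1 : K.starProjection (e n) = 0 := by
      rw [Submodule.starProjection_apply_eq_zero_iff]
      exact Submodule.le_orthogonal_orthogonal _ (Submodule.subset_span ⟨n, rfl⟩)
    have h3 := (hTx (e n)).unique (hasSum_single n fun m hm => by simp [hee, hm])
    simp only [B, add_apply, h1, zero_add]
    simpa [hee, hen] using h3
  have hvinner : ∀ n, inner ℂ (∑' m, (1 / 2 : ℂ) ^ m • e m) (e n) = (1 / 2 : ℂ) ^ n := by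
    intro n
    have h2 := (innerSL ℂ (e n)).hasSum hv.hasSum
    have h3 := h2.unique (hasSum_single n fun m hm => by
      simp [hee, hm.symm])
    rw [← inner_conj_symm]
    have h4 : inner ℂ (e n) (∑' m, (1 / 2 : ℂ) ^ m • e m) = (1 / 2 : ℂ) ^ n := by
      simpa [inner_smul_right, hee, hen] using h3
    rw [h4, map_pow, map_div₀, map_one, map_ofNat]
  refine ⟨B, ∑' m, (1 / 2 : ℂ) ^ m • e m, fun n => (2 : ℂ) ^ n • e n, ?_, ?_, ?_, ?_⟩
  · rw [injective_iff_map_eq_zero]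
    intro x hx
    rw [← hBK x, hx]
    rw [hKmem]
    intro n
    have h := hBinner n x
    rw [hx, inner_zero_right] at h
    simpa using h.symm
  · change Dense ((LinearMap.range B.toLinearMap : Submodule ℂ H) : Set H)
    rw [Submodule.dense_iff_topologicalClosure_eq_top,
      Submodule.topologicalClosure_eq_top_iff, Submodule.eq_bot_iff]
    intro y hy
    rw [Submodule.mem_orthogonal] at hy
    have hyK : y ∈ K := by
      rw [hKmem]
      intro n
      have h := hy (B (e n)) ⟨e n, rfl⟩
      rw [hBe, inner_smul_left] at h
      simpa using h
    have h := hy (B y) ⟨y, rfl⟩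
    rw [hBK y hyK] at h
    exact inner_self_eq_zero.1 h
  · intro n
    rw [inner_smul_right, hvinner, ← mul_pow]
    norm_num
  · rw [tendsto_zero_iff_norm_tendsto_zero]
    have h : ∀ n, ‖B ((2 : ℂ) ^ n • e n)‖ = (1 / 2 : ℝ) ^ n := by
      intro n
      rw [map_smul, hBe, smul_smul, ← mul_pow, norm_smul, hen, norm_pow]
      norm_num
    simp only [h]
    exact tendsto_pow_atTop_nhds_zero_of_lt_one (by norm_num) (by norm_num)

/-- `𝓡_f(𝓗)` is not a sub-generalized effect algebra of
`(𝓥_f(𝓗); ⊕, o)`: there are nonzero closable `t, r` and a nonzero singular `s` in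
`𝓥_f(𝓗)` with `D(t) = D(s) = D(r)` and `t + s = r`. -/
theorem stmt_4 [CompleteSpace H] (h_inf : ¬ FiniteDimensional ℂ H) :
    ¬ SubGEACond (fun t : PBF H => t.Closable) ∧
    ∃ t r s : PBF H, t.InVf ∧ r.InVf ∧ s.InVf ∧
      t.Closable ∧ r.Closable ∧ s.Singular ∧
      t ≠ zeroPBF H ∧ r ≠ zeroPBF H ∧ s ≠ zeroPBF H ∧
      t.dom = s.dom ∧ s.dom = r.dom ∧ PBF.IsSum t s r := by
  obtain ⟨B, v, u, hB, hd, hvu, hu⟩ := exists_injective_denseRange_tendsto_zero h_inf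
  let t := rangeForm B hB hd v 1 0 zero_le_one le_rfl
  let s := rangeForm B hB hd v 0 1 le_rfl zero_le_one
  let r := rangeForm B hB hd v 1 1 zero_le_one zero_le_one
  have ht : ¬ t.Bounded := rangeForm_not_bounded hB hd _ _ hvu hu (by norm_num)
  have hs : ¬ s.Bounded := rangeForm_not_bounded hB hd _ _ hvu hu (by norm_num)
  have hr : ¬ r.Bounded := rangeForm_not_bounded hB hd _ _ hvu hu (by norm_num)
  have htc : t.Closable := rangeForm_closable hB hd le_rfl
  have hrc : r.Closable := rangeForm_closable hB hd zero_le_one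
  have hss : s.Singular := rangeForm_singular hB hd zero_le_one hvu hu
  have hsum : PBF.IsSum t s r := by
    refine ⟨(inf_idem _).symm, ?_⟩
    rintro _ _ ⟨x, rfl⟩ ⟨y, rfl⟩
    simp only [ContinuousLinearMap.coe_coe, t, s, r, rangeForm_apply]
    simp
  have hne : ∀ p : PBF H, ¬ p.Bounded → p ≠ zeroPBF H := by
    rintro _ hp rfl
    exact hp ⟨0, fun x _ => by simp [zeroPBF]⟩
  refine ⟨fun h => ?_, t, r, s, fun h => absurd h ht, fun h => absurd h hr,
    fun h => absurd h hs, htc, hrc, hss, hne t ht, hne r hr, hne s hs, rfl, rfl, hsum⟩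
  have hsc := (h.2 t s r (fun h => absurd h ht) (fun h => absurd h hs) (fun h => absurd h hr)
    ⟨Or.inr (Or.inr rfl), hsum⟩ (Or.inr (Or.inl ⟨htc, hrc⟩))).2.1
  exact hs ⟨0, fun x _ => by simp [hss s hsc rfl (fun _ _ => le_rfl) x x]⟩
end
end

section
/- Let 𝓗 be an infinite-dimensional complex Hilbert space and let t, s ∈ 𝓥_f(𝓗) be such that t ⊕ s is defined. Then t_r + s_r ≤ (t+s)_r, i.e. t_r(x,x) + s_r(x,x) ≤ (t+s)_r(x,x) for all x ∈ D(t) ∩ D(s), where t_r, s_r, (t+s)_r denote the regular parts of t, s and t + s respectively. -/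
set_option autoImplicit false

noncomputable section

open Filter

variable {H : Type*}

variable [NormedAddCommGroup H] [InnerProductSpace ℂ H]

namespace PBF

open Classical in
/-- The usual sum of two positive bilinear forms whose domains have a dense intersection. -/
def add (t s : PBF H) (h : Dense ((t.dom ⊓ s.dom : Submodule ℂ H) : Set H)) : PBF H where
  dom := t.dom ⊓ s.dom
  dense' := h
  toFun x y := if x ∈ t.dom ⊓ s.dom ∧ y ∈ t.dom ⊓ s.dom then t.toFun x y + s.toFun x y else 0
  zero_off x y hxy := if_neg (by tauto)
  add_left x y z hx hy hz := by
    rw [if_pos ⟨add_mem hx hy, hz⟩, if_pos ⟨hx, hz⟩, if_pos ⟨hy, hz⟩,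
      t.add_left x y z hx.1 hy.1 hz.1, s.add_left x y z hx.2 hy.2 hz.2]
    ring
  smul_left c x y hx hy := by
    rw [if_pos ⟨Submodule.smul_mem _ c hx, hy⟩, if_pos ⟨hx, hy⟩,
      t.smul_left c x y hx.1 hy.1, s.smul_left c x y hx.2 hy.2]
    ring
  add_right x y z hx hy hz := by
    rw [if_pos ⟨hx, add_mem hy hz⟩, if_pos ⟨hx, hy⟩, if_pos ⟨hx, hz⟩,
      t.add_right x y z hx.1 hy.1 hz.1, s.add_right x y z hx.2 hy.2 hz.2]
    ring
  smul_right c x y hx hy := by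
    rw [if_pos ⟨hx, Submodule.smul_mem _ c hy⟩, if_pos ⟨hx, hy⟩,
      t.smul_right c x y hx.1 hy.1, s.smul_right c x y hx.2 hy.2]
    ring
  re_nonneg x hx := by
    rw [if_pos ⟨hx, hx⟩, Complex.add_re]
    exact add_nonneg (t.re_nonneg x hx.1) (s.re_nonneg x hx.2)
  im_zero x hx := by
    rw [if_pos ⟨hx, hx⟩, Complex.add_im, t.im_zero x hx.1, s.im_zero x hx.2, add_zero]

theorem add_toFun {t s : PBF H} (h : Dense ((t.dom ⊓ s.dom : Submodule ℂ H) : Set H)) {x y : H}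
    (hx : x ∈ t.dom ⊓ s.dom) (hy : y ∈ t.dom ⊓ s.dom) :
    (t.add s h).toFun x y = t.toFun x y + s.toFun x y :=
  if_pos ⟨hx, hy⟩

theorem norm_sq_le_q (t : PBF H) {x : H} (hx : x ∈ t.dom) : ‖x‖ ^ 2 ≤ t.q x :=
  le_add_of_nonneg_left (t.re_nonneg x hx)

theorem q_add {t s : PBF H} (h : Dense ((t.dom ⊓ s.dom : Submodule ℂ H) : Set H)) {x : H}
    (hx : x ∈ t.dom ⊓ s.dom) : (t.add s h).q x = t.q x + s.q x - ‖x‖ ^ 2 := by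
  simp only [q, add_toFun h hx hx, Complex.add_re]
  ring

/-- Convergence in the form norm implies convergence in norm. -/
theorem tendsto_of_tendsto_q (t : PBF H) {f : ℕ → H} {x : H} (hf : ∀ n, f n ∈ t.dom)
    (hx : x ∈ t.dom) (h : Tendsto (fun n => t.q (f n - x)) atTop (nhds 0)) :
    Tendsto f atTop (nhds x) := by
  have hsq : Tendsto (fun n => ‖f n - x‖ ^ 2) atTop (nhds 0) :=
    squeeze_zero (fun _ => sq_nonneg _) (fun n => t.norm_sq_le_q (sub_mem (hf n) hx)) h
  rw [tendsto_iff_norm_sub_tendsto_zero]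
  simpa using hsq.sqrt

theorem IsClosedForm.add {t s : PBF H} (ht : t.IsClosedForm) (hs : s.IsClosedForm)
    (h : Dense ((t.dom ⊓ s.dom : Submodule ℂ H) : Set H)) : (t.add s h).IsClosedForm := by
  intro f hf hcauchy
  have hft : ∀ n, f n ∈ t.dom := fun n => (hf n).1
  have hfs : ∀ n, f n ∈ s.dom := fun n => (hf n).2
  have hle : ∀ m n, t.q (f m - f n) ≤ (t.add s h).q (f m - f n) ∧
      s.q (f m - f n) ≤ (t.add s h).q (f m - f n) := by
    intro m n
    have hmem := sub_mem (hf m) (hf n)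
    have h₁ := t.norm_sq_le_q hmem.1
    have h₂ := s.norm_sq_le_q hmem.2
    rw [q_add h hmem]
    constructor <;> linarith
  obtain ⟨x, hx, hxlim⟩ := ht f hft fun ε hε =>
    (hcauchy ε hε).imp fun _ hN m hm n hn => (hle m n).1.trans_lt (hN m hm n hn)
  obtain ⟨y, hy, hylim⟩ := hs f hfs fun ε hε =>
    (hcauchy ε hε).imp fun _ hN m hm n hn => (hle m n).2.trans_lt (hN m hm n hn)
  obtain rfl : x = y := tendsto_nhds_unique (t.tendsto_of_tendsto_q hft hx hxlim)
    (s.tendsto_of_tendsto_q hfs hy hylim)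
  have hmem : ∀ n, f n - x ∈ t.dom ⊓ s.dom := fun n => sub_mem (hf n) ⟨hx, hy⟩
  refine ⟨x, ⟨hx, hy⟩, squeeze_zero (fun n => ?_) (fun n => ?_) (by simpa using hxlim.add hylim)⟩
  · exact (sq_nonneg _).trans ((t.add s h).norm_sq_le_q (hmem n))
  · rw [q_add h (hmem n)]
    exact sub_le_self _ (sq_nonneg _)

theorem Closable.add {t s : PBF H} (ht : t.Closable) (hs : s.Closable)
    (h : Dense ((t.dom ⊓ s.dom : Submodule ℂ H) : Set H)) : (t.add s h).Closable := by
  obtain ⟨T, hT, hTdom, hText⟩ := ht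
  obtain ⟨S, hS, hSdom, hSext⟩ := hs
  have hdom : t.dom ⊓ s.dom ≤ T.dom ⊓ S.dom := inf_le_inf hTdom hSdom
  have hd : Dense ((T.dom ⊓ S.dom : Submodule ℂ H) : Set H) := h.mono hdom
  refine ⟨T.add S hd, hT.add hS hd, hdom, fun x y hx hy => ?_⟩
  rw [add_toFun hd (hdom hx) (hdom hy), add_toFun h hx hy, hText x y hx.1 hy.1,
    hSext x y hx.2 hy.2]

end PBF

/-- If `t, s ∈ 𝓥_f(𝓗)` and `t ⊕ s = w` is defined, then
`t_r + s_r ≤ (t+s)_r` pointwise on `D(t) ⊓ D(s)`. -/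
theorem stmt_9 [CompleteSpace H] (h_inf : ¬ FiniteDimensional ℂ H)
    (t s w tr sr wr : PBF H)
    (htVf : t.InVf) (hsVf : s.InVf) (hwVf : w.InVf)
    (hw : PBF.Oplus t s w)
    (htr : t.IsRegularPart tr) (hsr : s.IsRegularPart sr) (hwr : w.IsRegularPart wr) :
    ∀ x : H, x ∈ t.dom ⊓ s.dom →
      (tr.toFun x x).re + (sr.toFun x x).re ≤ (wr.toFun x x).re := by
  obtain ⟨hwdom, hwsum⟩ := hw.2
  obtain ⟨htc, htd, htle, -⟩ := htr
  obtain ⟨hsc, hsd, hsle, -⟩ := hsr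
  have hdom : tr.dom ⊓ sr.dom = w.dom := by rw [htd, hsd, hwdom]
  have hd : Dense ((tr.dom ⊓ sr.dom : Submodule ℂ H) : Set H) := hdom ▸ w.dense'
  have hval : ∀ x ∈ w.dom, ((tr.add sr hd).toFun x x).re =
      (tr.toFun x x).re + (sr.toFun x x).re := fun x hx => by
    rw [← hdom] at hx
    rw [PBF.add_toFun hd hx hx, Complex.add_re]
  intro x hx
  rw [← hwdom] at hx
  rw [← hval x hx]
  refine hwr.2.2.2 (tr.add sr hd) (htc.add hsc hd) hdom (fun z hz => ?_) x hx
  rw [hval z hz, hwsum z z hz hz, Complex.add_re]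
  rw [hwdom] at hz
  exact add_le_add (htle z hz.1) (hsle z hz.2)
end
end

section
/- Let (E; ⊕, 0) be a generalized effect algebra. If E is monotone Dedekind upwards σ-complete, then E is monotone Dedekind downwards σ-complete; moreover, for a non-increasing sequence a₁ ≥ a₂ ≥ ⋯ in E, its infimum equals a₁ ⊖ a′ where a′ = ⋁_n (a₁ ⊖ a_n). -/
set_option autoImplicit false

/-- A generalized effect algebra: a set with a distinguished element `zero` and a partially
defined binary operation (encoded as an `Option`-valued total operation, `op a b = some c`
meaning "`a ⊕ b` is defined and equals `c`", `op a b = none` meaning "`a ⊕ b` is undefined")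
satisfying commutativity, associativity, the zero law, cancellation, and positivity;
each law is understood so that if one side is defined then so is the other. -/
structure GEA (E : Type*) where
  op : E → E → Option E
  zero : E
  comm : ∀ a b : E, op a b = op b a
  assoc : ∀ a b c : E,
    (op a b).bind (fun x => op x c) = (op b c).bind (fun y => op a y)
  op_zero : ∀ a : E, op a zero = some a
  cancel : ∀ a b c d : E, op a b = some d → op a c = some d → b = c
  pos_law : ∀ a b : E, op a b = some zero → a = zero ∧ b = zero

namespace GEA

variable {E : Type*} (G : GEA E)

/-- The induced partial order: `a ≤ b` iff `a ⊕ c = b` for some `c`. -/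
def le (a b : E) : Prop := ∃ c : E, G.op a c = some b

/-- `x` is the supremum of `S` with respect to the induced partial order. -/
def IsSup (S : Set E) (x : E) : Prop :=
  (∀ y ∈ S, G.le y x) ∧ ∀ z : E, (∀ y ∈ S, G.le y z) → G.le x z

/-- `x` is the infimum of `S` with respect to the induced partial order. -/
def IsInf (S : Set E) (x : E) : Prop :=
  (∀ y ∈ S, G.le x y) ∧ ∀ z : E, (∀ y ∈ S, G.le z y) → G.le z x

/-- `G` is monotone Dedekind upwards σ-complete: every non-decreasing sequence dominated
by some element has a supremum. -/
def UpSigmaComplete : Prop :=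
  ∀ f : ℕ → E, (∀ n, G.le (f n) (f (n + 1))) → (∃ b : E, ∀ n, G.le (f n) b) →
    ∃ s : E, G.IsSup (Set.range f) s

/-- `G` is monotone Dedekind downwards σ-complete: every non-increasing sequence has an
infimum. -/
def DownSigmaComplete : Prop :=
  ∀ f : ℕ → E, (∀ n, G.le (f (n + 1)) (f n)) → ∃ i : E, G.IsInf (Set.range f) i

/-- `G` is upwards directed: any two elements have a common upper bound. -/
def UpDirected : Prop := ∀ a b : E, ∃ c : E, G.le a c ∧ G.le b c

end GEA

namespace GEA

variable {E : Type*} (G : GEA E)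

theorem exists_op_right {a b c x y : E} (hab : G.op a b = some x) (hxc : G.op x c = some y) :
    ∃ z, G.op b c = some z ∧ G.op a z = some y := by
  have h := G.assoc a b c
  rw [hab, Option.bind_some, hxc] at h
  exact Option.bind_eq_some_iff.mp h.symm

theorem le_complement {a b c d t : E} (hab : G.op a b = some t) (hcd : G.op c d = some t)
    (hac : G.le a c) : G.le d b := by
  obtain ⟨e, he⟩ := hac
  obtain ⟨z, hz, haz⟩ := G.exists_op_right he hcd
  obtain rfl := G.cancel a z b t haz hab
  exact ⟨e, by rw [G.comm, hz]⟩

theorem le_apply_zero {f : ℕ → E} (hf : ∀ n, G.le (f (n + 1)) (f n)) (n : ℕ) :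
    G.le (f n) (f 0) := by
  induction n with
  | zero => exact ⟨G.zero, G.op_zero _⟩
  | succ n ih =>
    obtain ⟨u, hu⟩ := hf n
    obtain ⟨v, hv⟩ := ih
    obtain ⟨z, -, hz⟩ := G.exists_op_right hu hv
    exact ⟨z, hz⟩

theorem isInf_of_isSup_complement {ι : Type*} [Nonempty ι] {f d : ι → E} {t s c : E}
    (hd : ∀ i, G.op (f i) (d i) = some t) (hs : G.IsSup (Set.range d) s)
    (hc : G.op s c = some t) : G.IsInf (Set.range f) c := by
  have hd' : ∀ i, G.op (d i) (f i) = some t := fun i => by rw [G.comm, hd]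
  constructor
  · rintro _ ⟨i, rfl⟩
    exact G.le_complement (hd' i) hc (hs.1 _ ⟨i, rfl⟩)
  · intro z hz
    obtain ⟨i⟩ := ‹Nonempty ι›
    obtain ⟨u, hu⟩ := hz _ ⟨i, rfl⟩
    obtain ⟨w, -, hw⟩ := G.exists_op_right hu (hd i)
    refine G.le_complement hc (by rw [G.comm, hw]) (hs.2 w ?_)
    rintro _ ⟨j, rfl⟩
    exact G.le_complement hw (hd j) (hz _ ⟨j, rfl⟩)

end GEA

/-- A monotone Dedekind upwards σ-complete generalized effect algebra is
monotone Dedekind downwards σ-complete; moreover, for a non-increasing sequence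
`a₁ ≥ a₂ ≥ ⋯` its infimum equals `a₁ ⊖ a'` where `a' = ⋁ₙ (a₁ ⊖ aₙ)`. -/
theorem stmt_12 {E : Type*} (G : GEA E) (h : G.UpSigmaComplete) :
    G.DownSigmaComplete ∧
    ∀ (f d : ℕ → E) (a' c : E),
      (∀ n, G.le (f (n + 1)) (f n)) →
      -- `d n = a₁ ⊖ aₙ`, i.e. `aₙ ⊕ d n = a₁`
      (∀ n, G.op (f n) (d n) = some (f 0)) →
      -- `a' = ⋁ₙ (a₁ ⊖ aₙ)`
      G.IsSup (Set.range d) a' →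
      -- `c = a₁ ⊖ a'`
      G.op a' c = some (f 0) →
      G.IsInf (Set.range f) c := by
  refine ⟨fun f hf => ?_, fun f d a' c _ hd hs hc => G.isInf_of_isSup_complement hd hs hc⟩
  choose d hd using G.le_apply_zero hf
  have hd_le : ∀ n, G.le (d n) (f 0) := fun n => ⟨f n, by rw [G.comm, hd]⟩
  obtain ⟨s, hs⟩ := h d (fun n => G.le_complement (hd (n + 1)) (hd n) (hf n)) ⟨f 0, hd_le⟩
  obtain ⟨c, hc⟩ := hs.2 (f 0) (by rintro _ ⟨n, rfl⟩; exact hd_le n)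
  exact ⟨c, G.isInf_of_isSup_complement hd hs hc⟩
end
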